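/- Fix κ ∈ (0,1), q ∈ [0,1], w > 0, and a finite Borel measure μ on [0,1] having a continuous, everywhere positive density with respect to Lebesgue measure. If (f*,a*) is a pure-strategy Nash equilibrium, then the implied probability of Outcome 1 satisfies 1−κ < P^{f*,a*} < κ; in particular |P^{f*,a*} − 1/2| < κ − 1/2, so the equilibrium implied probability tends to 1/2 uniformly (in μ, q, w) as κ decreases to 1/2. -/

import Mathlib

open MeasureTheory Set

noncomputable section

/-- `μ` is a finite Borel measure on `[0,1]` with a continuous, everywhere positive
density with respect to Lebesgue measure. -/
def NiceDensity (μ : Measure ℝ) : Prop :=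
  ∃ g : ℝ → ℝ, ContinuousOn g (Icc 0 1) ∧ (∀ p ∈ Icc (0:ℝ) 1, 0 < g p) ∧
    μ = (volume.restrict (Icc (0:ℝ) 1)).withDensity (fun p => ENNReal.ofReal (g p))

/-- Total amount wagered by the diffuse players on Outcome 1. -/
def d1 (μ : Measure ℝ) (f : ℝ → ℝ × ℝ) : ℝ := ∫ p in Icc (0:ℝ) 1, (f p).1 ∂μ

/-- Total amount wagered by the diffuse players on Outcome 2. -/
def d2 (μ : Measure ℝ) (f : ℝ → ℝ × ℝ) : ℝ := ∫ p in Icc (0:ℝ) 1, (f p).2 ∂μ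

/-- The implied probability of Outcome 1, `P^{f,a}`. -/
def impliedProb (μ : Measure ℝ) (f : ℝ → ℝ × ℝ) (a : ℝ × ℝ) : ℝ :=
  (d1 μ f + a.1) / (d1 μ f + d2 μ f + a.1 + a.2)

/-- A feasible strategy profile for the diffuse players. -/
def FeasibleDiffuse (f : ℝ → ℝ × ℝ) : Prop :=
  Measurable f ∧ ∀ p ∈ Icc (0:ℝ) 1, 0 ≤ (f p).1 ∧ 0 ≤ (f p).2 ∧ (f p).1 + (f p).2 ≤ 1

/-- A feasible strategy profile for the atomic player. -/
def FeasibleAtomic (w : ℝ) (a : ℝ × ℝ) : Prop := 0 ≤ a.1 ∧ 0 ≤ a.2 ∧ a.1 + a.2 ≤ w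

/-- The expected profit of a bettor who believes Outcome 1 occurs with probability `p`,
betting `b1` on Outcome 1 and `b2` on Outcome 2, when the implied probability of
Outcome 1 is `P` (with the indicator conventions of the paper). -/
def payoff (κ P p b1 b2 : ℝ) : ℝ :=
  b1 * ((if P = 0 then 0 else κ * p / P) - 1) +
  b2 * ((if P = 1 then 0 else κ * (1 - p) / (1 - P)) - 1)

/-- A pure-strategy Nash equilibrium. -/
def IsEquilibrium (κ q w : ℝ) (μ : Measure ℝ) (f : ℝ → ℝ × ℝ) (a : ℝ × ℝ) : Prop :=
  FeasibleDiffuse f ∧ FeasibleAtomic w a ∧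
  0 < d1 μ f + d2 μ f + a.1 + a.2 ∧
  (∀ p ∈ Icc (0:ℝ) 1,
    payoff κ (impliedProb μ f a) p (f p).1 (f p).2 =
      sSup {x | ∃ b1 b2 : ℝ, 0 ≤ b1 ∧ 0 ≤ b2 ∧ b1 + b2 ≤ 1 ∧
        x = payoff κ (impliedProb μ f a) p b1 b2}) ∧
  payoff κ (impliedProb μ f a) q a.1 a.2 =
    sSup {x | ∃ b1 b2 : ℝ, 0 ≤ b1 ∧ 0 ≤ b2 ∧ b1 + b2 ≤ w ∧
      0 < d1 μ f + d2 μ f + b1 + b2 ∧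
      x = payoff κ (impliedProb μ f (b1, b2)) q b1 b2}

lemma payoff_swap (κ P p b1 b2 : ℝ) :
    payoff κ P p b1 b2 = payoff κ (1 - P) (1 - p) b2 b1 := by
  unfold payoff
  have e1 : (1 - P = 0) ↔ (P = 1) := ⟨fun h => by linarith, fun h => by linarith⟩
  have e2 : (1 - P = 1) ↔ (P = 0) := ⟨fun h => by linarith, fun h => by linarith⟩
  simp only [e1, e2, sub_sub_cancel]
  ring

/-- Diffuse players: if `κ ≤ P`, a player with belief `p < 1` puts nothing on Outcome 1. -/
lemma diffuse_core (κ P p x y : ℝ) (hκ : κ ∈ Ioo (0:ℝ) 1) (hP : κ ≤ P) (hp0 : 0 ≤ p) (hp : p < 1)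
    (hx : 0 ≤ x) (hle : payoff κ P p 0 y ≤ payoff κ P p x y) : x = 0 := by
  have hP0 : 0 < P := lt_of_lt_of_le hκ.1 hP
  unfold payoff at hle
  rw [if_neg hP0.ne'] at hle
  have h1 : κ * p / P < 1 := by
    rw [div_lt_one hP0]
    nlinarith [hκ.1]
  nlinarith

/-- Atomic player: with nothing else on Outcome 1, a positive bet on it is not optimal. -/
lemma atomic_core (κ q D a1 a2 : ℝ) (hκ : κ ∈ Ioo (0:ℝ) 1) (hq : q ∈ Icc (0:ℝ) 1) (hD : 0 ≤ D)
    (ha1 : 0 < a1) (ha2 : 0 ≤ a2)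
    (hle : payoff κ (a1 / 2 / (D + a1 / 2 + a2)) q (a1 / 2) a2 ≤
      payoff κ (a1 / (D + a1 + a2)) q a1 a2) : False := by
  obtain ⟨hκ0, hκ1⟩ := hκ
  obtain ⟨hq0, hq1⟩ := hq
  have key : ∀ b : ℝ, 0 < b → payoff κ (b / (D + b + a2)) q b a2 =
      κ * q * (D + b + a2) - b + (κ * (1 - q) * (a2 / (D + a2)) * (D + b + a2) - a2) := by
    intro b hb
    have hT : 0 < D + b + a2 := by linarith
    have h0 : b / (D + b + a2) ≠ 0 := (div_pos hb hT).ne'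
    unfold payoff
    rw [if_neg h0]
    rcases (add_nonneg hD ha2).eq_or_lt with hz | hpos
    · have : a2 = 0 := by linarith
      have : D = 0 := by linarith
      subst_vars
      simp
      field_simp
    · have hne : b / (D + b + a2) ≠ 1 := by
        rw [Ne, div_eq_one_iff_eq hT.ne']
        intro h; linarith
      rw [if_neg hne]
      have : 1 - b / (D + b + a2) = (D + a2) / (D + b + a2) := by
        field_simp; ring
      rw [this]
      field_simp
  rw [key a1 ha1, key (a1 / 2) (by linarith)] at hle
  set r := a2 / (D + a2)
  have hr : r ≤ 1 := div_le_one_of_le₀ (by linarith) (by linarith)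
  have h3 : κ * (1 - q) * r ≤ κ * (1 - q) * 1 :=
    mul_le_mul_of_nonneg_left hr (mul_nonneg hκ0.le (by linarith))
  have h4 : 0 < 1 - κ * q - κ * (1 - q) * r := by linarith
  nlinarith [mul_pos ha1 h4]

lemma payoff_le_abs (κ P p b1 b2 w : ℝ) (h1 : 0 ≤ b1) (h2 : 0 ≤ b2) (h : b1 + b2 ≤ w) :
    payoff κ P p b1 b2 ≤ w * |(if P = 0 then 0 else κ * p / P) - 1| +
      w * |(if P = 1 then 0 else κ * (1 - p) / (1 - P)) - 1| := by
  unfold payoff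
  have aux : ∀ b A : ℝ, 0 ≤ b → b ≤ w → b * A ≤ w * |A| := fun b A hb hb' =>
    (mul_le_mul_of_nonneg_left (le_abs_self A) hb).trans
      (mul_le_mul_of_nonneg_right hb' (abs_nonneg A))
  exact add_le_add (aux _ _ h1 (by linarith)) (aux _ _ h2 (by linarith))

lemma half_bound (κ q b D T : ℝ) (hκ : κ ∈ Ioo (0:ℝ) 1) (hq : q ∈ Icc (0:ℝ) 1) (hb : 0 ≤ b)
    (hD : 0 ≤ D) (hT : 0 < T) :
    b * ((if (D + b) / T = 0 then 0 else κ * q / ((D + b) / T)) - 1) ≤ T := by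
  obtain ⟨hκ0, hκ1⟩ := hκ
  obtain ⟨hq0, hq1⟩ := hq
  split_ifs with h
  · linarith
  · have hne : D + b ≠ 0 := fun h' => h (by rw [h', zero_div])
    have hp : 0 < D + b := lt_of_le_of_ne (by linarith) hne.symm
    have e : b * (κ * q / ((D + b) / T) - 1) = (κ * q) * (b / (D + b)) * T - b := by
      field_simp
    have hr : b / (D + b) ≤ 1 := div_le_one_of_le₀ (by linarith) hp.le
    have hr0 : 0 ≤ b / (D + b) := by positivity
    have hk : κ * q ≤ 1 := by nlinarith
    have : (κ * q) * (b / (D + b)) ≤ 1 := mul_le_one₀ hk hr0 hr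
    rw [e]
    nlinarith

lemma atomic_bound (κ q b1 b2 D1 D2 : ℝ) (hκ : κ ∈ Ioo (0:ℝ) 1) (hq : q ∈ Icc (0:ℝ) 1)
    (h1 : 0 ≤ b1) (h2 : 0 ≤ b2) (hD1 : 0 ≤ D1) (hD2 : 0 ≤ D2) (hT : 0 < D1 + D2 + b1 + b2) :
    payoff κ ((D1 + b1) / (D1 + D2 + b1 + b2)) q b1 b2 ≤ 2 * (D1 + D2 + b1 + b2) := by
  set T := D1 + D2 + b1 + b2 with hTdef
  have hA := half_bound κ q b1 D1 T hκ hq h1 hD1 hT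
  have hB := half_bound κ (1 - q) b2 D2 T hκ ⟨by linarith [hq.2], by linarith [hq.1]⟩ h2 hD2 hT
  have e : 1 - (D1 + b1) / T = (D2 + b2) / T := by
    rw [eq_div_iff hT.ne', sub_mul, div_mul_cancel₀ _ hT.ne']; linarith
  have e1 : ((D1 + b1) / T = 1) ↔ ((D2 + b2) / T = 0) := by
    rw [← e]; exact ⟨fun h => by linarith, fun h => by linarith⟩
  unfold payoff
  simp only [e1, e]
  linarith

lemma integral_zero_of_off_point (μ : Measure ℝ) (hμ : NiceDensity μ) (c : ℝ) (g : ℝ → ℝ)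
    (hg : ∀ p ∈ Icc (0:ℝ) 1, p ≠ c → g p = 0) : ∫ p in Icc (0:ℝ) 1, g p ∂μ = 0 := by
  obtain ⟨ρ, -, -, rfl⟩ := hμ
  have hac := withDensity_absolutelyContinuous (volume.restrict (Icc (0:ℝ) 1))
    (fun p => ENNReal.ofReal (ρ p))
  set ν := (volume.restrict (Icc (0:ℝ) 1)).withDensity (fun p => ENNReal.ofReal (ρ p))
  have h0 : ν {c} = 0 := hac (by simp)
  apply integral_eq_zero_of_ae
  have hne : ∀ᵐ p ∂(ν.restrict (Icc (0:ℝ) 1)), p ≠ c := by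
    apply ae_restrict_of_ae
    rw [ae_iff]
    simpa using h0
  filter_upwards [hne, ae_restrict_mem measurableSet_Icc] with p hp hp'
  exact hg p hp' hp

/-- Corollary: in equilibrium the implied probability of Outcome 1 lies strictly
between `1 - κ` and `κ`; in particular it is within `κ - 1/2` of `1/2`, so it tends
to `1/2` uniformly as `κ ↓ 1/2`. -/
theorem stmt_8 (κ q w : ℝ) (hκ : κ ∈ Ioo (0:ℝ) 1) (hq : q ∈ Icc (0:ℝ) 1) (hw : 0 < w)
    (μ : Measure ℝ) (hμ : NiceDensity μ)
    (f : ℝ → ℝ × ℝ) (a : ℝ × ℝ) (h : IsEquilibrium κ q w μ f a) :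
    1 - κ < impliedProb μ f a ∧ impliedProb μ f a < κ ∧
      |impliedProb μ f a - 1/2| < κ - 1/2 := by
  obtain ⟨⟨-, hf⟩, ⟨ha1, ha2, haw⟩, hT, hdiff, hat⟩ := h
  have hd1 : 0 ≤ d1 μ f := setIntegral_nonneg measurableSet_Icc fun p hp => (hf p hp).1
  have hd2 : 0 ≤ d2 μ f := setIntegral_nonneg measurableSet_Icc fun p hp => (hf p hp).2.1
  have hdiff' : ∀ p ∈ Icc (0:ℝ) 1, ∀ b1 b2 : ℝ, 0 ≤ b1 → 0 ≤ b2 → b1 + b2 ≤ 1 →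
      payoff κ (impliedProb μ f a) p b1 b2 ≤
        payoff κ (impliedProb μ f a) p (f p).1 (f p).2 := by
    intro p hp b1 b2 h1 h2 h12
    rw [hdiff p hp]
    refine le_csSup ⟨1 * |(if impliedProb μ f a = 0 then 0 else κ * p / impliedProb μ f a) - 1| +
      1 * |(if impliedProb μ f a = 1 then 0 else κ * (1 - p) / (1 - impliedProb μ f a)) - 1|, ?_⟩
      ⟨b1, b2, h1, h2, h12, rfl⟩
    rintro x ⟨c1, c2, g1, g2, g12, rfl⟩
    exact payoff_le_abs κ _ p c1 c2 1 g1 g2 g12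
  have hat' : ∀ b1 b2 : ℝ, 0 ≤ b1 → 0 ≤ b2 → b1 + b2 ≤ w → 0 < d1 μ f + d2 μ f + b1 + b2 →
      payoff κ (impliedProb μ f (b1, b2)) q b1 b2 ≤
        payoff κ (impliedProb μ f a) q a.1 a.2 := by
    intro b1 b2 h1 h2 h12 hpos
    rw [hat]
    refine le_csSup ⟨2 * (d1 μ f + d2 μ f + w), ?_⟩ ⟨b1, b2, h1, h2, h12, hpos, rfl⟩
    rintro x ⟨c1, c2, g1, g2, g12, gpos, rfl⟩
    have := atomic_bound κ q c1 c2 _ _ hκ hq g1 g2 hd1 hd2 gpos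
    unfold impliedProb
    simp only
    linarith
  have hup : impliedProb μ f a < κ := by
    by_contra hcon
    push Not at hcon
    have hz : d1 μ f = 0 := by
      apply integral_zero_of_off_point μ hμ 1
      intro p hp hp1
      obtain ⟨hx, hy, hxy⟩ := hf p hp
      exact diffuse_core κ _ p _ _ hκ hcon hp.1 (lt_of_le_of_ne hp.2 hp1) hx
        (hdiff' p hp 0 (f p).2 le_rfl hy (by linarith))
    have hP0 : 0 < impliedProb μ f a := lt_of_lt_of_le hκ.1 hcon
    have ha1' : 0 < a.1 := by
      rcases ha1.eq_or_lt with h | h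
      · exfalso
        simp [impliedProb, hz, ← h] at hP0
      · exact h
    have hle := hat' (a.1 / 2) a.2 (by linarith) ha2 (by linarith) (by linarith)
    simp only [impliedProb, hz, zero_add] at hle
    exact atomic_core κ q (d2 μ f) a.1 a.2 hκ hq hd2 ha1' ha2 hle
  have hlow : 1 - κ < impliedProb μ f a := by
    by_contra hcon
    push Not at hcon
    have hz : d2 μ f = 0 := by
      apply integral_zero_of_off_point μ hμ 0
      intro p hp hp1
      obtain ⟨hx, hy, hxy⟩ := hf p hp
      have hle := hdiff' p hp (f p).1 0 hx le_rfl (by linarith)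
      rw [payoff_swap, payoff_swap κ _ p (f p).1 (f p).2] at hle
      have : 0 < p := lt_of_le_of_ne hp.1 (Ne.symm hp1)
      exact diffuse_core κ _ (1 - p) _ _ hκ (by linarith) (by linarith [hp.2]) (by linarith)
        hy hle
    have hcomp : ∀ b1 b2 : ℝ, 0 < d1 μ f + d2 μ f + b1 + b2 →
        1 - impliedProb μ f (b1, b2) = b2 / (d1 μ f + b2 + b1) := by
      intro b1 b2 hpos
      rw [hz] at hpos
      have : 0 < d1 μ f + b2 + b1 := by linarith
      have e : d1 μ f + 0 + b1 + b2 = d1 μ f + b2 + b1 := by ring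
      simp only [impliedProb, hz, e]
      field_simp
      ring
    have hca := hcomp a.1 a.2 hT
    rw [Prod.mk.eta] at hca
    have ha2' : 0 < a.2 := by
      rcases ha2.eq_or_lt with h | h
      · exfalso
        rw [← h, zero_div] at hca
        linarith [hκ.1]
      · exact h
    have hpos' : 0 < d1 μ f + d2 μ f + a.1 + a.2 / 2 := by linarith
    have hle := hat' a.1 (a.2 / 2) ha1 (by linarith) (by linarith) hpos'
    rw [payoff_swap, payoff_swap κ _ q a.1 a.2, hca, hcomp _ _ hpos'] at hle
    exact atomic_core κ (1 - q) (d1 μ f) a.2 a.1 hκ ⟨by linarith [hq.2], by linarith [hq.1]⟩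
      hd1 ha2' ha1 hle
  refine ⟨hlow, hup, ?_⟩
  rw [abs_lt]
  constructor <;> linarith
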